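/- arXiv:2407.07438 — 3 statements merged into one kernel-verified Lean document; each statement's English description precedes it below -/
import Mathlib

section
/- Let A, B, C be n×n positive definite complex matrices such that (A^{1/2} B A^{1/2})^{1/2} A^{-1} (A^{1/2} C A^{1/2})^{1/2} is Hermitian. If B ≤ C in the Loewner order, then A ♮_t B ⪯ A ♮_t C in the near-order for every t ∈ (0, 1]. -/
open Matrix
open scoped ComplexOrder

/-- Real power of a matrix via functional calculus on the spectrum (junk value
if the matrix is not Hermitian). -/
noncomputable def mrpow {n : ℕ} (A : Matrix (Fin n) (Fin n) ℂ) (r : ℝ) :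
    Matrix (Fin n) (Fin n) ℂ :=
  if hA : A.IsHermitian then
    (hA.eigenvectorUnitary : Matrix (Fin n) (Fin n) ℂ) *
      diagonal (fun i => ((hA.eigenvalues i ^ r : ℝ) : ℂ)) *
      (star (hA.eigenvectorUnitary : Matrix (Fin n) (Fin n) ℂ))
  else A

/-- The metric geometric mean `A # B = A^{1/2} (A^{-1/2} B A^{-1/2})^{1/2} A^{1/2}`. -/
noncomputable def sharp {n : ℕ} (A B : Matrix (Fin n) (Fin n) ℂ) :
    Matrix (Fin n) (Fin n) ℂ :=
  mrpow A (1/2) * mrpow (mrpow A (-(1/2)) * B * mrpow A (-(1/2))) (1/2) * mrpow A (1/2)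

/-- The Loewner order `A ≤ B`, i.e. `B - A` is positive semidefinite. -/
def loewnerLE {n : ℕ} (A B : Matrix (Fin n) (Fin n) ℂ) : Prop := (B - A).PosSemidef

/-- The near-order `A ⪯ B`, i.e. `A⁻¹ # B ≥ I` in the Loewner order. -/
def nearLE {n : ℕ} (A B : Matrix (Fin n) (Fin n) ℂ) : Prop := loewnerLE 1 (sharp A⁻¹ B)

/-- The spectral geometric mean `A ♮ₜ B = (A⁻¹ # B)^t A (A⁻¹ # B)^t`. -/
noncomputable def spectralGM {n : ℕ} (t : ℝ) (A B : Matrix (Fin n) (Fin n) ℂ) :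
    Matrix (Fin n) (Fin n) ℂ :=
  mrpow (sharp A⁻¹ B) t * A * mrpow (sharp A⁻¹ B) t

open scoped MatrixOrder Matrix.Norms.L2Operator

section helpers

variable {n : ℕ}

lemma mrpow_eq {A : Matrix (Fin n) (Fin n) ℂ} (hA : A.PosDef) (r : ℝ) :
    mrpow A r = A ^ r := by
  have h0 : 0 ≤ A := nonneg_iff_posSemidef.mpr hA.posSemidef
  rw [CFC.rpow_eq_cfc_real h0, hA.isHermitian.cfc_eq, mrpow, dif_pos hA.isHermitian]
  simp [IsHermitian.cfc, Unitary.conjStarAlgAut_apply, Function.comp_def]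

lemma mrpow_posDef {A : Matrix (Fin n) (Fin n) ℂ} (hA : A.PosDef) (r : ℝ) :
    (mrpow A r).PosDef := by
  rw [mrpow_eq hA, ← isStrictlyPositive_iff_posDef]
  exact IsStrictlyPositive.rpow _ r (isStrictlyPositive_iff_posDef.mpr hA)

lemma mrpow_mul {A : Matrix (Fin n) (Fin n) ℂ} (hA : A.PosDef) (r s : ℝ) :
    mrpow A r * mrpow A s = mrpow A (r + s) := by
  rw [mrpow_eq hA, mrpow_eq hA, mrpow_eq hA, CFC.rpow_add hA.isUnit]

lemma mrpow_zero {A : Matrix (Fin n) (Fin n) ℂ} (hA : A.PosDef) : mrpow A 0 = 1 := by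
  rw [mrpow_eq hA, CFC.rpow_zero A (nonneg_iff_posSemidef.mpr hA.posSemidef)]

lemma mrpow_one {A : Matrix (Fin n) (Fin n) ℂ} (hA : A.PosDef) : mrpow A 1 = A := by
  rw [mrpow_eq hA, CFC.rpow_one A (nonneg_iff_posSemidef.mpr hA.posSemidef)]

lemma mrpow_inv {A : Matrix (Fin n) (Fin n) ℂ} (hA : A.PosDef) (r : ℝ) :
    mrpow A⁻¹ r = mrpow A (-r) := by
  have h0 : 0 ≤ A := nonneg_iff_posSemidef.mpr hA.posSemidef
  have h1 : A⁻¹ = A ^ (-1 : ℝ) := by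
    rw [← mrpow_eq hA]
    apply Matrix.inv_eq_right_inv
    nth_rewrite 1 [← mrpow_one hA]
    rw [mrpow_mul hA, ← mrpow_zero hA]
    norm_num
  rw [mrpow_eq hA.inv, mrpow_eq hA, h1, CFC.rpow_rpow A _ _ (by norm_num) (isStrictlyPositive_iff_posDef.mpr hA)]
  norm_num

lemma mrpow_le {A B : Matrix (Fin n) (Fin n) ℂ} (hA : A.PosDef) (hB : B.PosDef) (h : A ≤ B)
    {t : ℝ} (h0 : 0 ≤ t) (h1 : t ≤ 1) : mrpow A t ≤ mrpow B t := by
  rw [mrpow_eq hA, mrpow_eq hB]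
  exact CFC.rpow_le_rpow ⟨h0, h1⟩ h

lemma mrpow_commute {A B : Matrix (Fin n) (Fin n) ℂ} (hA : A.PosDef) (h : Commute A B) (t : ℝ) :
    Commute (mrpow A t) B := by
  rw [mrpow_eq hA, CFC.rpow_def]
  exact h.cfc_nnreal _

lemma conj_posDef {S M : Matrix (Fin n) (Fin n) ℂ} (hS : S.PosDef) (hM : M.PosDef) :
    (S * M * S).PosDef := by
  have := hM.conjTranspose_mul_mul_same (B := S)
    (Matrix.mulVec_injective_iff_isUnit.mpr hS.isUnit)
  rwa [hS.isHermitian.eq] at this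

lemma conj_le {S M N : Matrix (Fin n) (Fin n) ℂ} (hS : S.PosDef) (h : M ≤ N) :
    S * M * S ≤ S * N * S := by
  have := star_left_conjugate_le_conjugate h S
  rwa [star_eq_conjTranspose, hS.isHermitian.eq] at this

lemma mrpow_half_sq {S : Matrix (Fin n) (Fin n) ℂ} (hS : S.PosDef) :
    mrpow (S * S) (1/2) = S := by
  have h2 : (S * S).PosDef := by
    have := conj_posDef hS (M := 1) .one
    rwa [mul_one] at this
  have h0 : 0 ≤ S := nonneg_iff_posSemidef.mpr hS.posSemidef
  rw [mrpow_eq h2, ← CFC.sqrt_eq_rpow]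
  exact CFC.sqrt_mul_self S h0

lemma mrpow_half_mul_neg {A : Matrix (Fin n) (Fin n) ℂ} (hA : A.PosDef) (t : ℝ) :
    mrpow A t * mrpow A (-t) = 1 := by
  rw [mrpow_mul hA, add_neg_cancel, mrpow_zero hA]

lemma mrpow_neg_mul_half {A : Matrix (Fin n) (Fin n) ℂ} (hA : A.PosDef) (t : ℝ) :
    mrpow A (-t) * mrpow A t = 1 := by
  rw [mrpow_mul hA, neg_add_cancel, mrpow_zero hA]

lemma mrpow_half_mul_half {A : Matrix (Fin n) (Fin n) ℂ} (hA : A.PosDef) :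
    mrpow A (1/2) * mrpow A (1/2) = A := by
  rw [mrpow_mul hA]
  norm_num [mrpow_one hA]

lemma sharp_inv {M N : Matrix (Fin n) (Fin n) ℂ} (hM : M.PosDef) :
    sharp M⁻¹ N = mrpow M (-(1/2)) * mrpow (mrpow M (1/2) * N * mrpow M (1/2)) (1/2) *
      mrpow M (-(1/2)) := by
  rw [sharp, mrpow_inv hM, mrpow_inv hM, neg_neg]

lemma sharp_inv_unique {M Z : Matrix (Fin n) (Fin n) ℂ} (hM : M.PosDef) (hZ : Z.PosDef) :
    sharp M⁻¹ (Z * M * Z) = Z := by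
  have e := mrpow_half_mul_half hM
  have f := mrpow_half_mul_neg hM (1/2)
  have g := mrpow_neg_mul_half hM (1/2)
  have hR := mrpow_posDef hM (1/2)
  rw [sharp_inv hM]
  generalize mrpow M (1/2) = R at *
  generalize mrpow M (-(1/2)) = T at *
  have : R * (Z * M * Z) * R = (R * Z * R) * (R * Z * R) := by
    rw [← e]; noncomm_ring
  rw [this, mrpow_half_sq (conj_posDef hR hZ)]
  calc T * (R * Z * R) * T = (T * R) * Z * (R * T) := by noncomm_ring
    _ = Z := by rw [f, g, one_mul, mul_one]

lemma sharp_inv_posDef {M N : Matrix (Fin n) (Fin n) ℂ} (hM : M.PosDef) (hN : N.PosDef) :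
    (sharp M⁻¹ N).PosDef := by
  rw [sharp_inv hM]
  exact conj_posDef (mrpow_posDef hM _) (mrpow_posDef (conj_posDef (mrpow_posDef hM _) hN) _)

lemma sharp_inv_le {M N K : Matrix (Fin n) (Fin n) ℂ} (hM : M.PosDef) (hN : N.PosDef)
    (hK : K.PosDef) (h : N ≤ K) : sharp M⁻¹ N ≤ sharp M⁻¹ K := by
  rw [sharp_inv hM, sharp_inv hM]
  have hR := mrpow_posDef hM (1/2)
  exact conj_le (mrpow_posDef hM _)
    (mrpow_le (conj_posDef hR hN) (conj_posDef hR hK) (conj_le hR h) (by norm_num) (by norm_num))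

lemma sharp_commute {A B C : Matrix (Fin n) (Fin n) ℂ}
    (hA : A.PosDef) (hB : B.PosDef) (hC : C.PosDef)
    (hherm : (mrpow (mrpow A (1/2) * B * mrpow A (1/2)) (1/2) * A⁻¹ *
      mrpow (mrpow A (1/2) * C * mrpow A (1/2)) (1/2)).IsHermitian) :
    Commute (sharp A⁻¹ B) (sharp A⁻¹ C) := by
  have hR := mrpow_posDef hA (1/2)
  have hT := (mrpow_posDef hA (-(1/2))).isHermitian.eq
  have hP := (mrpow_posDef (conj_posDef hR hB) (1/2)).isHermitian.eq
  have hQ := (mrpow_posDef (conj_posDef hR hC) (1/2)).isHermitian.eq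
  have hi : A⁻¹ = mrpow A (-(1/2)) * mrpow A (-(1/2)) := by
    rw [← mrpow_inv hA, mrpow_half_mul_half hA.inv]
  rw [sharp_inv hA, sharp_inv hA]
  have h := hherm.eq
  rw [conjTranspose_mul, conjTranspose_mul, hP, hQ, hA.inv.isHermitian.eq, hi] at h
  generalize mrpow A (-(1/2)) = T at *
  generalize mrpow (mrpow A (1/2) * B * mrpow A (1/2)) (1/2) = P at *
  generalize mrpow (mrpow A (1/2) * C * mrpow A (1/2)) (1/2) = Q at *
  show T * P * T * (T * Q * T) = T * Q * T * (T * P * T)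
  calc T * P * T * (T * Q * T) = T * (P * (T * T) * Q) * T := by noncomm_ring
    _ = T * (Q * (T * T * P)) * T := by rw [h]
    _ = _ := by noncomm_ring

end helpers

theorem spectralGM_nearLE_of_loewnerLE {n : ℕ} (A B C : Matrix (Fin n) (Fin n) ℂ)
    (hA : A.PosDef) (hB : B.PosDef) (hC : C.PosDef)
    (hherm : (mrpow (mrpow A (1/2) * B * mrpow A (1/2)) (1/2) * A⁻¹ *
      mrpow (mrpow A (1/2) * C * mrpow A (1/2)) (1/2)).IsHermitian)
    (hBC : loewnerLE B C) (t : ℝ) (ht0 : 0 < t) (ht1 : t ≤ 1) :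
    nearLE (spectralGM t A B) (spectralGM t A C) := by
  have hX := sharp_inv_posDef hA hB
  have hY := sharp_inv_posDef hA hC
  have hXY : sharp A⁻¹ B ≤ sharp A⁻¹ C := sharp_inv_le hA hB hC hBC
  have hcomm := sharp_commute hA hB hC hherm
  unfold nearLE spectralGM
  generalize sharp A⁻¹ B = X at *
  generalize sharp A⁻¹ C = Y at *
  have hle := mrpow_le hX hY hXY ht0.le ht1
  have hc2 (s : ℝ) : Commute (mrpow X s) (mrpow Y t) :=
    (mrpow_commute hY (mrpow_commute hX hcomm s).symm t).symm
  have hU := mrpow_posDef hX t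
  have hV := mrpow_posDef hY t
  have hH := mrpow_posDef hX (-(t/2))
  have h1 : mrpow X (-(t/2)) * mrpow X t * mrpow X (-(t/2)) = 1 := by
    rw [mrpow_mul hX, mrpow_mul hX, ← mrpow_zero hX]; congr 1; ring
  have h2 : mrpow X (-(t/2)) * mrpow X (-(t/2)) * mrpow X t = 1 := by
    rw [mrpow_mul hX, mrpow_mul hX, ← mrpow_zero hX]; congr 1; ring
  have h3 : mrpow X t * (mrpow X (-(t/2)) * mrpow X (-(t/2))) = 1 := by
    rw [mrpow_mul hX, mrpow_mul hX, ← mrpow_zero hX]; congr 1; ring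
  have hc := (hc2 (-(t/2))).eq
  generalize mrpow X t = U at *
  generalize mrpow Y t = V at *
  generalize mrpow X (-(t/2)) = H at *
  have hZ := conj_posDef hH hV
  have hZ1 : H * V * H = V * (H * H) := by rw [hc, mul_assoc]
  have hZ2 : H * V * H = (H * H) * V := by rw [mul_assoc, ← hc, mul_assoc]
  have key : V * A * V = (H * V * H) * (U * A * U) * (H * V * H) := by
    nth_rewrite 1 [hZ1]
    rw [hZ2]
    calc V * A * V = V * 1 * A * 1 * V := by noncomm_ring
      _ = V * (H * H * U) * A * (U * (H * H)) * V := by rw [h2, h3]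
      _ = _ := by noncomm_ring
  rw [key, sharp_inv_unique (conj_posDef hU hA) hZ]
  have := conj_le hH hle
  rw [h1] at this
  exact this
end

section
/- Let A₁, …, A_N and B₁, …, B_N be n×n positive definite complex matrices, let ω = (w₁, …, w_N) be a positive probability vector, and let p satisfy 0 < p ≤ 1. If Aⱼ ≤ Bⱼ in the Loewner order for every j = 1, …, N, then Q_p(ω; A₁, …, A_N) ⪯ Q_p(ω; B₁, …, B_N) in the near-order. -/
open Matrix
open scoped ComplexOrder

/-- The quasi-arithmetic mean `Q_p(ω; A₁, …, A_N) = (Σⱼ wⱼ Aⱼ^p)^{1/p}`. -/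
noncomputable def quasiArith {n N : ℕ} (w : Fin N → ℝ) (p : ℝ)
    (A : Fin N → Matrix (Fin n) (Fin n) ℂ) : Matrix (Fin n) (Fin n) ℂ :=
  mrpow (∑ j, w j • mrpow (A j) p) (1/p)

namespace NearOrderAux

section Abstract

variable {R : Type*} [CStarAlgebra R] [PartialOrder R] [StarOrderedRing R]

/-- Abstract geometric mean in a unital C*-algebra. -/
noncomputable def gm (a b : R) : R :=
  a ^ (1/2 : ℝ) * (a ^ (-(1/2) : ℝ) * b * a ^ (-(1/2) : ℝ)) ^ (1/2 : ℝ) * a ^ (1/2 : ℝ)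

lemma half_mul_half {a : R} (ha : IsStrictlyPositive a) :
    a ^ (1/2 : ℝ) * a ^ (1/2 : ℝ) = a := by
  rw [← CFC.rpow_add ha.isUnit]
  norm_num
  exact CFC.rpow_one a

lemma sp_conj {a : R} (ha : IsStrictlyPositive a) (x : ℝ) {b : R} (hb : IsStrictlyPositive b) :
    IsStrictlyPositive (a ^ x * b * a ^ x) :=
  IsStrictlyPositive.conjugate_of_isUnit_of_isSelfAdjoint b (a ^ x)
    (ha.rpow a x).isUnit (ha.rpow a x).isSelfAdjoint hb

lemma rpow_unitary_conj (u : unitary R) {a : R} (ha : IsStrictlyPositive a) (t : ℝ) :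
    ((u : R) * a * star (u : R)) ^ t = (u : R) * a ^ t * star (u : R) := by
  have hb : 0 ≤ (u : R) * a * star (u : R) := star_right_conjugate_nonneg ha.nonneg _
  have h := StarAlgHomClass.map_cfc (S := ℂ) (Unitary.conjStarAlgAut ℂ R u) (fun x : ℝ => x ^ t) a
    (hf := by
      intro x hx
      have : 0 < x := ha.spectrum_pos hx
      exact (Real.continuousAt_rpow_const _ _ (Or.inl this.ne')).continuousWithinAt)
    (hφ := by
      change Continuous fun x : R => (u : R) * x * star (u : R)
      fun_prop)
    (ha := ha.isSelfAdjoint) (hφa := hb.isSelfAdjoint)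
  rw [CFC.rpow_eq_cfc_real hb, CFC.rpow_eq_cfc_real ha.nonneg]
  exact h.symm

/-- `(d d*)^(t+1) = d (d* d)^t d*`. -/
lemma rpow_polar {d : R} (hd : IsUnit d) (t : ℝ) :
    (d * star d) ^ (t + 1) = d * (star d * d) ^ t * star d := by
  have hb : IsStrictlyPositive (d * star d) :=
    CStarAlgebra.isStrictlyPositive_iff_eq_mul_star_self.mpr ⟨d, hd, rfl⟩
  have hc : IsStrictlyPositive (star d * d) :=
    CStarAlgebra.isStrictlyPositive_iff_eq_star_mul_self.mpr ⟨d, hd, rfl⟩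
  set b := d * star d with hbdef
  set k := b ^ (-(1/2) : ℝ) with hk
  have hks : star k = k := (hb.rpow b _).isSelfAdjoint
  have hh := half_mul_half hb
  have hkh : k * b ^ (1/2 : ℝ) = 1 := CFC.rpow_neg_mul_rpow _ hb
  have hhk : b ^ (1/2 : ℝ) * k = 1 := CFC.rpow_mul_rpow_neg _ hb
  have hkk : k * b * k = 1 := by
    calc k * b * k = (k * b ^ (1/2 : ℝ)) * (b ^ (1/2 : ℝ) * k) := by
          conv_lhs => rw [← hh]
          noncomm_ring
      _ = 1 := by rw [hkh, hhk, one_mul]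
  have h1 : (k * d) * star (k * d) = 1 := by
    rw [star_mul, hks, ← hkk, hbdef]; noncomm_ring
  have hu : IsUnit (k * d) := (hb.rpow b _).isUnit.mul hd
  have h2 : star (k * d) * (k * d) = 1 := by
    obtain ⟨v, hv⟩ := hu
    rw [← hv] at h1 ⊢
    have : star (v : R) = ↑v⁻¹ := by
      rw [eq_comm]; exact Units.inv_eq_of_mul_eq_one_right h1
    rw [this]; simp
  let u : unitary R := ⟨k * d, Unitary.mem_iff.mpr ⟨h2, h1⟩⟩
  have hdu : d = b ^ (1/2 : ℝ) * (u : R) := by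
    change d = b ^ (1/2 : ℝ) * (k * d)
    rw [← mul_assoc, hhk, one_mul]
  have hcb : (u : R) * (star d * d) * star (u : R) = b := by
    change (k * d) * (star d * d) * star (k * d) = b
    calc (k * d) * (star d * d) * star (k * d) = k * b * b * k := by
          rw [star_mul, hks, hbdef]; noncomm_ring
      _ = (k * b ^ (1/2 : ℝ)) * b ^ (1/2 : ℝ) * b ^ (1/2 : ℝ) * (b ^ (1/2 : ℝ) * k) := by
          conv_lhs => rw [← hh]
          noncomm_ring
      _ = b := by rw [hkh, hhk, one_mul, mul_one, hh]
  have hbt := rpow_unitary_conj u hc t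
  rw [hcb] at hbt
  have hsd : star d = star (u : R) * b ^ (1/2 : ℝ) := by
    conv_lhs => rw [hdu]
    rw [star_mul, (hb.rpow b (1/2)).isSelfAdjoint.star_eq]
  calc b ^ (t + 1) = b ^ (1/2 : ℝ) * b ^ t * b ^ (1/2 : ℝ) := by
        rw [← CFC.rpow_add hb.isUnit, ← CFC.rpow_add hb.isUnit]; ring_nf
    _ = (b ^ (1/2 : ℝ) * (u : R)) * (star d * d) ^ t * (star (u : R) * b ^ (1/2 : ℝ)) := by
        rw [hbt]; noncomm_ring
    _ = _ := by rw [← hdu, ← hsd]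

lemma le_gm {a b z : R} (ha : IsStrictlyPositive a) (hz : 0 ≤ z)
    (h : z * a ^ (-1 : ℝ) * z ≤ b) : z ≤ gm a b := by
  have hh : 0 ≤ a ^ (1/2 : ℝ) := CFC.rpow_nonneg
  have hk : 0 ≤ a ^ (-(1/2) : ℝ) := CFC.rpow_nonneg
  have hkh : a ^ (-(1/2) : ℝ) * a ^ (1/2 : ℝ) = 1 := CFC.rpow_neg_mul_rpow _ ha
  have hhk : a ^ (1/2 : ℝ) * a ^ (-(1/2) : ℝ) = 1 := CFC.rpow_mul_rpow_neg _ ha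
  have hkk : a ^ (-1 : ℝ) = a ^ (-(1/2) : ℝ) * a ^ (-(1/2) : ℝ) := by
    rw [← CFC.rpow_add ha.isUnit]; norm_num
  unfold gm
  set x := a ^ (1/2 : ℝ)
  set k := a ^ (-(1/2) : ℝ)
  have h1 := conjugate_le_conjugate_of_nonneg h hk
  have h2 : k * (z * a ^ (-1 : ℝ) * z) * k = (k * z * k) * (k * z * k) := by
    rw [hkk]; noncomm_ring
  rw [h2] at h1
  have h3 := CFC.sqrt_le_sqrt _ _ h1
  rw [CFC.sqrt_mul_self _ (conjugate_nonneg_of_nonneg hz hk), CFC.sqrt_eq_rpow] at h3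
  have h4 := conjugate_le_conjugate_of_nonneg h3 hh
  have h5 : x * (k * z * k) * x = z := by
    calc x * (k * z * k) * x = (x * k) * z * (k * x) := by noncomm_ring
      _ = z := by rw [hkh, hhk, one_mul, mul_one]
  rwa [h5] at h4

/-- Ando–Hiai step. -/
lemma ando_hiai_step {a b : R} (ha : IsStrictlyPositive a) (hb : IsStrictlyPositive b)
    (h : 1 ≤ gm a b) {r : ℝ} (hr1 : 1 ≤ r) (hr2 : r ≤ 2) :
    1 ≤ gm (a ^ r) (b ^ r) := by
  refine h.trans ?_
  have hr0 : r ≠ 0 := by linarith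
  have hmem : r - 1 ∈ Set.Icc (0 : ℝ) 1 := ⟨by linarith, by linarith⟩
  have hxs := (ha.rpow a (1/2))
  have hks := (ha.rpow a (-(1/2)))
  have hkh : a ^ (-(1/2) : ℝ) * a ^ (1/2 : ℝ) = 1 := CFC.rpow_neg_mul_rpow _ ha
  have hhk : a ^ (1/2 : ℝ) * a ^ (-(1/2) : ℝ) = 1 := CFC.rpow_mul_rpow_neg _ ha
  have hkk : a ^ (-1 : ℝ) = a ^ (-(1/2) : ℝ) * a ^ (-(1/2) : ℝ) := by
    rw [← CFC.rpow_add ha.isUnit]; norm_num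
  have hc : IsStrictlyPositive (a ^ (-(1/2) : ℝ) * b * a ^ (-(1/2) : ℝ)) := sp_conj ha _ hb
  have har : (a ^ r) ^ (-1 : ℝ) =
      a ^ (-(1/2) : ℝ) * (a ^ (-1 : ℝ)) ^ (r - 1) * a ^ (-(1/2) : ℝ) := by
    rw [CFC.rpow_rpow _ _ _ hr0, CFC.rpow_rpow _ _ _ (by norm_num), ← CFC.rpow_add ha.isUnit,
      ← CFC.rpow_add ha.isUnit]
    ring_nf
  have hss := half_mul_half hc
  have hs := hc.rpow _ (1/2)
  have hz : IsStrictlyPositive (gm a b) := sp_conj ha _ hs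
  refine le_gm (ha.rpow a r) hz.nonneg ?_
  rw [har]
  have hzz : gm a b ≤ gm a b * gm a b := by
    have h1 := conjugate_le_conjugate_of_nonneg h (hz.rpow _ (1/2)).nonneg
    rw [mul_one, half_mul_half hz] at h1
    refine h1.trans (le_of_eq ?_)
    have h2 := half_mul_half hz
    set q := (gm a b) ^ (1/2 : ℝ)
    rw [← h2]; noncomm_ring
  have hxx := half_mul_half ha
  unfold gm at *
  set x := a ^ (1/2 : ℝ)
  set k := a ^ (-(1/2) : ℝ)
  set s := (k * b * k) ^ (1/2 : ℝ)
  -- `a⁻¹ ≤ s`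
  have e1 : a ^ (-1 : ℝ) ≤ s := by
    have h1 := conjugate_le_conjugate_of_nonneg h hks.nonneg
    have h2 : k * (x * s * x) * k = s := by
      calc k * (x * s * x) * k = (k * x) * s * (x * k) := by noncomm_ring
        _ = s := by rw [hkh, hhk, one_mul, mul_one]
    rwa [h2, mul_one, ← hkk] at h1
  -- `s ≤ s a s`
  have e2 : s ≤ star (x * s) * (x * s) := by
    have h1 := conjugate_le_conjugate_of_nonneg hzz hks.nonneg
    have h2 : k * (x * s * x) * k = s := by
      calc k * (x * s * x) * k = (k * x) * s * (x * k) := by noncomm_ring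
        _ = s := by rw [hkh, hhk, one_mul, mul_one]
    have h3 : k * (x * s * x * (x * s * x)) * k = star (x * s) * (x * s) := by
      rw [star_mul, hxs.isSelfAdjoint.star_eq, hs.isSelfAdjoint.star_eq]
      calc k * (x * s * x * (x * s * x)) * k = (k * x) * (s * x * (x * s)) * (x * k) := by
            noncomm_ring
        _ = _ := by rw [hkh, hhk, one_mul, mul_one]
    rwa [h2, h3] at h1
  have hd : IsUnit (x * s) := hxs.isUnit.mul hs.isUnit
  have hbd : b = (x * s) * star (x * s) := by
    rw [star_mul, hxs.isSelfAdjoint.star_eq, hs.isSelfAdjoint.star_eq]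
    calc b = (x * k) * b * (k * x) := by rw [hkh, hhk, one_mul, mul_one]
      _ = x * (k * b * k) * x := by noncomm_ring
      _ = x * (s * s) * x := by rw [hss]
      _ = _ := by noncomm_ring
  have f1 := CFC.rpow_le_rpow hmem e1
  have f2 := f1.trans (CFC.rpow_le_rpow hmem e2)
  have f3 := star_right_conjugate_le_conjugate f2 (x * s)
  rw [← rpow_polar hd, ← hbd, sub_add_cancel, star_mul, hxs.isSelfAdjoint.star_eq,
    hs.isSelfAdjoint.star_eq] at f3
  refine le_trans (le_of_eq ?_) f3
  generalize (a ^ (-1 : ℝ)) ^ (r - 1) = y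
  calc x * s * x * (k * y * k) * (x * s * x) = x * s * (x * k) * y * (k * x) * s * x := by
        noncomm_ring
    _ = _ := by rw [hkh, hhk, mul_one, mul_one]; noncomm_ring

lemma ando_hiai_aux (m : ℕ) : ∀ {a b : R}, IsStrictlyPositive a → IsStrictlyPositive b →
    1 ≤ gm a b → ∀ r : ℝ, 1 ≤ r → r ≤ 2 ^ m → 1 ≤ gm (a ^ r) (b ^ r) := by
  induction m with
  | zero =>
    intro a b ha hb h r h1 h2
    exact ando_hiai_step ha hb h h1 (by norm_num at h2; linarith)
  | succ m ih =>
    intro a b ha hb h r h1 h2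
    by_cases hr : r ≤ 2
    · exact ando_hiai_step ha hb h h1 hr
    · have := ih (ha.rpow a 2) (hb.rpow b 2)
        (ando_hiai_step ha hb h (by norm_num) le_rfl) (r / 2) (by linarith)
        (by rw [pow_succ] at h2; linarith)
      rw [CFC.rpow_rpow _ _ _ (by norm_num), CFC.rpow_rpow _ _ _ (by norm_num)] at this
      rwa [mul_div_cancel₀ _ (by norm_num)] at this

lemma ando_hiai {a b : R} (ha : IsStrictlyPositive a) (hb : IsStrictlyPositive b)
    (h : 1 ≤ gm a b) {r : ℝ} (h1 : 1 ≤ r) : 1 ≤ gm (a ^ r) (b ^ r) := by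
  obtain ⟨m, hm⟩ := pow_unbounded_of_one_lt r (one_lt_two)
  exact ando_hiai_aux m ha hb h r h1 hm.le

lemma main_abs {x y : R} (hx : IsStrictlyPositive x) (hy : IsStrictlyPositive y) (h : x ≤ y)
    {q : ℝ} (hq : 1 ≤ q) : 1 ≤ gm ((x ^ q) ^ (-1 : ℝ)) (y ^ q) := by
  have h0 : 1 ≤ gm (x ^ (-1 : ℝ)) y := by
    refine le_gm (hx.rpow _ _) zero_le_one ?_
    rw [CFC.rpow_rpow _ _ _ (by norm_num)]
    norm_num
    rwa [CFC.rpow_one x]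
  have := ando_hiai (hx.rpow _ _) hy h0 hq
  rw [CFC.rpow_rpow _ _ _ (by norm_num)] at this
  rwa [CFC.rpow_rpow _ _ _ (by linarith), mul_comm]

end Abstract

section Mat

open scoped MatrixOrder Matrix.Norms.L2Operator

lemma mrpow_eq {n : ℕ} {A : Matrix (Fin n) (Fin n) ℂ} (hA : A.PosDef) (r : ℝ) :
    mrpow A r = A ^ r := by
  have hA0 : (0 : Matrix (Fin n) (Fin n) ℂ) ≤ A := hA.posSemidef.nonneg
  have hH : A.IsHermitian := hA.1
  have hA' : IsSelfAdjoint A := hH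
  rw [CFC.rpow_eq_cfc_real hA0, mrpow, dif_pos hH]
  have := cfcHom_eq_of_continuous_of_map_id hA' hH.cfcAux hH.isClosedEmbedding_cfcAux.continuous
    hH.cfcAux_id
  rw [cfc_apply _ A hA' (by rw [continuousOn_iff_continuous_domRestrict]; fun_prop), this]
  rfl

lemma pd {n : ℕ} {A : Matrix (Fin n) (Fin n) ℂ} (hA : A.PosDef) : IsStrictlyPositive A :=
  hA.isStrictlyPositive

lemma rpow_pd {n : ℕ} {A : Matrix (Fin n) (Fin n) ℂ} (hA : A.PosDef) (r : ℝ) :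
    (A ^ r).PosDef :=
  Matrix.isStrictlyPositive_iff_posDef.mp ((pd hA).rpow A r)

lemma inv_eq {n : ℕ} {A : Matrix (Fin n) (Fin n) ℂ} (hA : A.PosDef) :
    A⁻¹ = A ^ (-1 : ℝ) := by
  rw [← CFC.inverse_eq_rpow_neg_one (pd hA), Matrix.nonsing_inv_eq_ringInverse]

lemma sharp_eq {n : ℕ} {A B : Matrix (Fin n) (Fin n) ℂ} (hA : A.PosDef) (hB : B.PosDef) :
    sharp A B = gm A B := by
  have := Matrix.isStrictlyPositive_iff_posDef.mp (sp_conj (pd hA) (-(1/2)) (pd hB))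
  rw [sharp, mrpow_eq hA, mrpow_eq hA, mrpow_eq this, gm]

lemma sum_pd {n N : ℕ} {A : Fin N → Matrix (Fin n) (Fin n) ℂ} (hA : ∀ j, (A j).PosDef)
    {w : Fin N → ℝ} (hw : ∀ j, 0 < w j) (hw1 : ∑ j, w j = 1) :
    (∑ j, w j • A j).PosDef := by
  have hj : Nonempty (Fin N) := by
    by_contra hne
    rw [not_nonempty_iff] at hne
    simp at hw1
  obtain ⟨i⟩ := hj
  rw [← Finset.add_sum_erase _ _ (Finset.mem_univ i)]
  refine Matrix.PosDef.add_posSemidef ((hA i).smul (hw i)) ?_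
  exact Matrix.posSemidef_sum _ fun j _ => ((hA j).smul (hw j)).posSemidef

theorem main {n N : ℕ}
    (A B : Fin N → Matrix (Fin n) (Fin n) ℂ)
    (hA : ∀ j, (A j).PosDef) (hB : ∀ j, (B j).PosDef)
    (w : Fin N → ℝ) (hw : ∀ j, 0 < w j) (hw1 : ∑ j, w j = 1)
    (p : ℝ) (hp0 : 0 < p) (hp1 : p ≤ 1)
    (hAB : ∀ j, loewnerLE (A j) (B j)) :
    nearLE (quasiArith w p A) (quasiArith w p B) := by
  have hX := sum_pd (fun j => rpow_pd (hA j) p) hw hw1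
  have hY := sum_pd (fun j => rpow_pd (hB j) p) hw hw1
  have hXY : ∑ j, w j • (A j) ^ p ≤ ∑ j, w j • (B j) ^ p := by
    refine Finset.sum_le_sum fun j _ => ?_
    have hj : A j ≤ B j := hAB j
    exact smul_le_smul_of_nonneg_left (CFC.rpow_le_rpow ⟨hp0.le, hp1⟩ hj) (hw j).le
  have hq : 1 ≤ 1 / p := by rw [le_div_iff₀ hp0]; linarith
  have key := main_abs (pd hX) (pd hY) hXY hq
  have e1 : ∀ {C : Fin N → Matrix (Fin n) (Fin n) ℂ}, (∀ j, (C j).PosDef) →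
      quasiArith w p C = (∑ j, w j • (C j) ^ p) ^ (1 / p) := by
    intro C hC
    rw [quasiArith]
    simp only [mrpow_eq (hC _)]
    exact mrpow_eq (sum_pd (fun j => rpow_pd (hC j) p) hw hw1) _
  rw [nearLE, e1 hA, e1 hB, inv_eq (rpow_pd hX _),
    sharp_eq (rpow_pd (rpow_pd hX _) _) (rpow_pd hY _)]
  exact key

end Mat
end NearOrderAux

theorem quasiArith_nearLE_monotone_pos {n N : ℕ}
    (A B : Fin N → Matrix (Fin n) (Fin n) ℂ)
    (hA : ∀ j, (A j).PosDef) (hB : ∀ j, (B j).PosDef)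
    (w : Fin N → ℝ) (hw : ∀ j, 0 < w j) (hw1 : ∑ j, w j = 1)
    (p : ℝ) (hp0 : 0 < p) (hp1 : p ≤ 1)
    (hAB : ∀ j, loewnerLE (A j) (B j)) :
    nearLE (quasiArith w p A) (quasiArith w p B) := by
  exact NearOrderAux.main A B hA hB w hw hw1 p hp0 hp1 hAB
end

section
/- Let A₁, …, A_N and B₁, …, B_N be n×n positive definite complex matrices, let ω = (w₁, …, w_N) be a positive probability vector, and let p satisfy -1 ≤ p < 0. If Aⱼ ≤ Bⱼ in the Loewner order for every j = 1, …, N, then Q_p(ω; A₁, …, A_N) ⪯ Q_p(ω; B₁, …, B_N) in the near-order. -/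
open Matrix
open scoped ComplexOrder

section Abstract

variable {X : Type*} [CStarAlgebra X] [PartialOrder X] [StarOrderedRing X]

/-- Geometric mean in a C⋆-algebra. -/
noncomputable def csharp (a b : X) : X :=
  a ^ (1/2 : ℝ) * (a ^ (-(1/2) : ℝ) * b * a ^ (-(1/2) : ℝ)) ^ (1/2 : ℝ) * a ^ (1/2 : ℝ)

lemma csharp_rpow_anti {a b : X} (ha : IsStrictlyPositive a) (hab : a ≤ b) {q : ℝ}
    (h0 : 0 ≤ q) (h1 : q ≤ 1) : b ^ (-q) ≤ a ^ (-q) := by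
  have hb : IsStrictlyPositive b := ha.of_le hab
  have h := CFC.rpow_le_rpow (p := q) ⟨h0, h1⟩ (CStarAlgebra.rpow_neg_one_le_rpow_neg_one hab ha)
  rwa [CFC.rpow_rpow a _ _ (by norm_num) ha, CFC.rpow_rpow b _ _ (by norm_num) hb,
    neg_one_mul] at h

lemma csharp_half_mul_half {c : X} (hc : IsStrictlyPositive c) :
    c ^ (-(1/2) : ℝ) * c ^ (-(1/2) : ℝ) = c ^ (-1 : ℝ) := by
  rw [← CFC.rpow_add hc.isUnit]; norm_num

/-- If `G c⁻¹ G ≤ b` with `G ≥ 0` then `G ≤ c # b`. -/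
lemma le_csharp {c G b : X} (hc : IsStrictlyPositive c) (hG : 0 ≤ G)
    (h : G * c ^ (-1 : ℝ) * G ≤ b) : G ≤ csharp c b := by
  unfold csharp
  have hrr := csharp_half_mul_half hc
  have hsr := CFC.rpow_mul_rpow_neg (1/2) hc
  have hrs := CFC.rpow_neg_mul_rpow (1/2) hc
  have hs0 : 0 ≤ c ^ (1/2 : ℝ) := CFC.rpow_nonneg
  have hr0 : 0 ≤ c ^ (-(1/2) : ℝ) := CFC.rpow_nonneg
  generalize c ^ (1/2 : ℝ) = s at *
  generalize c ^ (-(1/2) : ℝ) = r at *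
  have h1 : 0 ≤ r * G * r := conjugate_nonneg_of_nonneg hG hr0
  have h2 : (r * G * r) * (r * G * r) ≤ r * b * r := by
    have := conjugate_le_conjugate_of_nonneg h hr0
    rw [← hrr] at this
    simpa only [mul_assoc] using this
  have h3 := CFC.rpow_le_rpow (p := 1/2) ⟨by norm_num, by norm_num⟩ h2
  have h4 : ((r * G * r) * (r * G * r)) ^ (1/2 : ℝ) = r * G * r := by
    rw [← pow_two, ← CFC.rpow_natCast _ 2 h1,
      CFC.rpow_rpow_of_exponent_nonneg _ _ _ (by norm_num) (by norm_num) h1]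
    norm_num
    exact CFC.rpow_one _ h1
  rw [h4] at h3
  have h5 := conjugate_le_conjugate_of_nonneg h3 hs0
  have h6 : s * (r * G * r) * s = G := by
    calc s * (r * G * r) * s = (s * r) * G * (r * s) := by simp only [mul_assoc]
      _ = G := by rw [hsr, hrs]; simp
  rwa [h6] at h5

lemma csharp_riccati {c b : X} (hc : IsStrictlyPositive c) (hb : 0 ≤ b) :
    csharp c b * c ^ (-1 : ℝ) * csharp c b = b := by
  unfold csharp
  rw [← csharp_half_mul_half hc]
  have hsr := CFC.rpow_mul_rpow_neg (1/2) hc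
  have hrs := CFC.rpow_neg_mul_rpow (1/2) hc
  have hr0 : 0 ≤ c ^ (-(1/2) : ℝ) := CFC.rpow_nonneg
  generalize c ^ (1/2 : ℝ) = s at *
  generalize c ^ (-(1/2) : ℝ) = r at *
  have h1 : 0 ≤ r * b * r := conjugate_nonneg_of_nonneg hb hr0
  have h2 : (r * b * r) ^ (1/2 : ℝ) * (r * b * r) ^ (1/2 : ℝ) = r * b * r := by
    have h0 : 0 ≤ (r * b * r) ^ (1/2 : ℝ) := CFC.rpow_nonneg
    rw [← pow_two, ← CFC.rpow_natCast _ 2 h0,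
      CFC.rpow_rpow_of_exponent_nonneg _ _ _ (by norm_num) (by norm_num) h1]
    norm_num
    exact CFC.rpow_one _ h1
  generalize (r * b * r) ^ (1/2 : ℝ) = m at *
  calc s * m * s * (r * r) * (s * m * s) = s * m * (s * r) * (r * s) * m * s := by
        simp only [mul_assoc]
    _ = s * (m * m) * s := by rw [hsr, hrs]; simp only [mul_assoc, mul_one, one_mul]
    _ = (s * r) * b * (r * s) := by rw [h2]; simp only [mul_assoc]
    _ = b := by rw [hsr, hrs]; simp

lemma csharp_double {c d : X} (hc : IsStrictlyPositive c) (hd : 0 ≤ d)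
    (h : 1 ≤ csharp c d) : 1 ≤ csharp (c * c) (d * d) := by
  have hG : 0 ≤ csharp c d := zero_le_one.trans h
  have hR := csharp_riccati hc hd
  refine h.trans ?_
  have hcc : c * c = c ^ (2 : ℝ) := by
    rw [← pow_two, ← CFC.rpow_natCast c 2 hc.nonneg]; norm_num
  have hccp : IsStrictlyPositive (c * c) := hcc ▸ IsStrictlyPositive.rpow c 2 hc
  apply le_csharp hccp hG
  have hinv : (c * c) ^ (-1 : ℝ) = c ^ (-1 : ℝ) * c ^ (-1 : ℝ) := by
    rw [hcc, CFC.rpow_rpow c _ _ (by norm_num) hc, ← CFC.rpow_add hc.isUnit]; norm_num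
  rw [hinv]
  have hi : 0 ≤ c ^ (-1 : ℝ) := CFC.rpow_nonneg
  generalize csharp c d = G at *
  generalize c ^ (-1 : ℝ) = i at *
  have hGG : 1 ≤ G * G := by
    have := conjugate_le_conjugate_of_nonneg h (CFC.rpow_nonneg (a := G) (y := 1/2))
    have e : G ^ (1/2 : ℝ) * G ^ (1/2 : ℝ) = G := by
      rw [← pow_two, ← CFC.rpow_natCast _ 2 CFC.rpow_nonneg,
        CFC.rpow_rpow_of_exponent_nonneg _ _ _ (by norm_num) (by norm_num) hG]
      norm_num
      exact CFC.rpow_one _ hG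
    have e2 : G ^ (1/2 : ℝ) * G * G ^ (1/2 : ℝ) = G * G := by
      generalize G ^ (1/2 : ℝ) = t at *
      rw [← e]; simp only [mul_assoc]
    rw [mul_one, e, e2] at this
    exact h.trans this
  have h1 := conjugate_le_conjugate_of_nonneg (conjugate_le_conjugate_of_nonneg hGG hi) hG
  rw [← hR]
  simpa only [mul_assoc, one_mul] using h1

lemma csharp_furuta {S T : X} (hT : IsStrictlyPositive T) (hTS : T ≤ S) (k : ℕ) :
    ∀ q : ℝ, 0 ≤ q → q ≤ 2 ^ k → 1 ≤ csharp (S ^ q) (T ^ (-q)) := by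
  have hS : IsStrictlyPositive S := hT.of_le hTS
  induction k with
  | zero =>
    intro q h0 h1
    apply le_csharp (IsStrictlyPositive.rpow S q hS) zero_le_one
    rw [one_mul, mul_one]
    have : (S ^ q) ^ (-1 : ℝ) = S ^ (-q) := by
      rcases eq_or_ne q 0 with rfl | hq
      · simp [CFC.rpow_zero S hS.nonneg]
      · rw [CFC.rpow_rpow S _ _ hq hS]; ring_nf
    rw [this]
    exact csharp_rpow_anti hT hTS h0 (by simpa using h1)
  | succ k ih =>
    intro q h0 h1
    have h2 := csharp_double (IsStrictlyPositive.rpow S (q/2) hS) CFC.rpow_nonneg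
      (ih (q/2) (by linarith) (by rw [pow_succ] at h1; linarith))
    rw [← CFC.rpow_add hS.isUnit, ← CFC.rpow_add hT.isUnit] at h2
    convert h2 using 3 <;> ring

end Abstract

section Concrete
open scoped MatrixOrder Matrix.Norms.L2Operator

lemma mrpow_eq_rpow {n : ℕ} {A : Matrix (Fin n) (Fin n) ℂ} (hA : 0 ≤ A) (r : ℝ) :
    mrpow A r = A ^ r := by
  have hH : A.IsHermitian := (Matrix.nonneg_iff_posSemidef.mp hA).isHermitian
  rw [CFC.rpow_eq_cfc_real hA, hH.cfc_eq, mrpow, dif_pos hH]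
  rfl

lemma sharp_eq_csharp {n : ℕ} {A B : Matrix (Fin n) (Fin n) ℂ} (hA : 0 ≤ A) (hB : 0 ≤ B) :
    sharp A B = csharp A B := by
  unfold sharp csharp
  simp only [mrpow_eq_rpow hA]
  rw [mrpow_eq_rpow (conjugate_nonneg_of_nonneg hB CFC.rpow_nonneg)]

end Concrete

open scoped MatrixOrder Matrix.Norms.L2Operator in
theorem quasiArith_aux {n N : ℕ}
    (A B : Fin N → Matrix (Fin n) (Fin n) ℂ)
    (hA : ∀ j, (A j).PosDef) (hB : ∀ j, (B j).PosDef)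
    (w : Fin N → ℝ) (hw : ∀ j, 0 < w j) (hw1 : ∑ j, w j = 1)
    (p : ℝ) (hp0 : -1 ≤ p) (hp1 : p < 0)
    (hAB : ∀ j, loewnerLE (A j) (B j)) :
    nearLE (quasiArith w p A) (quasiArith w p B) := by
  have hA' j : IsStrictlyPositive (A j) := (hA j).isStrictlyPositive
  have hB' j : IsStrictlyPositive (B j) := (hB j).isStrictlyPositive
  have hAB' j : A j ≤ B j := hAB j
  have hN : (Finset.univ : Finset (Fin N)).Nonempty := by
    rw [Finset.nonempty_iff_ne_empty]
    intro h
    rw [h] at hw1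
    simp at hw1
  have pos : ∀ C : Fin N → Matrix (Fin n) (Fin n) ℂ, (∀ j, IsStrictlyPositive (C j)) →
      IsStrictlyPositive (∑ j, w j • C j ^ p) := by
    intro C hC
    obtain ⟨i, hi⟩ := hN
    have h1 : IsStrictlyPositive (w i • C i ^ p) :=
      IsStrictlyPositive.smul (hw i) (IsStrictlyPositive.rpow (C i) p (hC i))
    refine h1.of_le ?_
    exact Finset.single_le_sum (f := fun j => w j • C j ^ p)
      (fun j _ => smul_nonneg (hw j).le CFC.rpow_nonneg) hi
  have hS := pos A hA'
  have hT := pos B hB'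
  have hTS : ∑ j, w j • B j ^ p ≤ ∑ j, w j • A j ^ p := by
    refine Finset.sum_le_sum fun j _ => ?_
    refine smul_le_smul_of_nonneg_left ?_ (hw j).le
    have := csharp_rpow_anti (q := -p) (hA' j) (hAB' j) (by linarith) (by linarith)
    simpa using this
  have eA : quasiArith w p A = (∑ j, w j • A j ^ p) ^ (1/p) := by
    unfold quasiArith
    simp only [fun j => mrpow_eq_rpow (hA' j).nonneg p]
    rw [mrpow_eq_rpow hS.nonneg]
  have eB : quasiArith w p B = (∑ j, w j • B j ^ p) ^ (1/p) := by
    unfold quasiArith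
    simp only [fun j => mrpow_eq_rpow (hB' j).nonneg p]
    rw [mrpow_eq_rpow hT.nonneg]
  rw [eA, eB]
  generalize ∑ j, w j • A j ^ p = S at *
  generalize ∑ j, w j • B j ^ p = T at *
  have hinv : (S ^ (1/p))⁻¹ = S ^ (-(1/p)) :=
    Matrix.inv_eq_right_inv (CFC.rpow_mul_rpow_neg (1/p) hS)
  unfold nearLE
  rw [hinv, sharp_eq_csharp CFC.rpow_nonneg CFC.rpow_nonneg]
  obtain ⟨k, hk⟩ := pow_unbounded_of_one_lt (-(1/p)) (one_lt_two)
  have hq : 0 ≤ -(1/p) := by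
    have := (one_div_neg.mpr hp1); linarith
  have := csharp_furuta hT hTS k (-(1/p)) hq hk.le
  rw [neg_neg] at this
  exact this

theorem quasiArith_nearLE_monotone_neg {n N : ℕ}
    (A B : Fin N → Matrix (Fin n) (Fin n) ℂ)
    (hA : ∀ j, (A j).PosDef) (hB : ∀ j, (B j).PosDef)
    (w : Fin N → ℝ) (hw : ∀ j, 0 < w j) (hw1 : ∑ j, w j = 1)
    (p : ℝ) (hp0 : -1 ≤ p) (hp1 : p < 0)
    (hAB : ∀ j, loewnerLE (A j) (B j)) :
    nearLE (quasiArith w p A) (quasiArith w p B) :=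
  quasiArith_aux A B hA hB w hw hw1 p hp0 hp1 hAB
end
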